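/- For every u > 1 and every natural number d there exists k > 1 (depending only on u and d) with the following property: if K is a nontrivial finitely generated locally indicable group such that every finitely generated subgroup H of K satisfies either ω(H) ≥ u, or H ≅ ℤⁿ for some n ≤ d, or H is isomorphic to the Klein bottle group, and if α is an automorphism of K with no periodic conjugacy classes, then the semidirect product G = K ⋊_α ℤ satisfies ω(G) ≥ k. -/

import Mathlib

universe u

open Filter

/-- The set of elements of `G` expressible as a word of length at most `n`
in elements of `S` and their inverses. -/
def wordBall {G : Type*} [Group G] (S : Finset G) (n : ℕ) : Set G :=
  { g | ∃ l : List G, l.length ≤ n ∧ (∀ x ∈ l, x ∈ S ∨ x⁻¹ ∈ S) ∧ l.prod = g }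

/-- `ω(G,S)`: the exponential growth rate of `G` with respect to the finite set `S`,
i.e. the limit (= limsup, since the limit exists by submultiplicativity) of `γ_S(n)^(1/n)`. -/
noncomputable def growthRate {G : Type*} [Group G] (S : Finset G) : ℝ :=
  Filter.limsup (fun n : ℕ => ((wordBall S n).ncard : ℝ) ^ (1 / (n : ℝ))) Filter.atTop

/-- `ω(G)`: the growth constant of `G`, the infimum of `ω(G,S)` over all finite
generating sets `S` of `G`. -/
noncomputable def growthOmega (G : Type*) [Group G] : ℝ :=
  sInf { r : ℝ | ∃ S : Finset G, Subgroup.closure (S : Set G) = ⊤ ∧ growthRate S = r }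
/-- The single relator `t a t⁻¹ a` of the Klein bottle group `⟨a, t | t a t⁻¹ = a⁻¹⟩`,
with generator `0` playing the role of `a` and generator `1` the role of `t`. -/
def kleinBottleRels : Set (FreeGroup (Fin 2)) :=
  {FreeGroup.of 1 * FreeGroup.of 0 * (FreeGroup.of 1)⁻¹ * FreeGroup.of 0}

/-- The Klein bottle group `⟨a, t | t a t⁻¹ = a⁻¹⟩`. -/
abbrev KleinBottleGroup : Type := PresentedGroup kleinBottleRels
/-- The action of `Multiplicative ℤ` on `K` whose generator acts by the automorphism `α`. -/
def zAction {K : Type*} [Group K] (α : MulAut K) : Multiplicative ℤ →* MulAut K where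
  toFun n := α ^ (Multiplicative.toAdd n)
  map_one' := by simp
  map_mul' m n := by simp [zpow_add]

/-- The semidirect product `K ⋊_α ℤ`, i.e. the non-proper HNN extension of `K` by `α`. -/
abbrev zSemidirect (K : Type*) [Group K] (α : MulAut K) :=
  SemidirectProduct K (Multiplicative ℤ) (zAction α)
/-- The automorphism `α` of `K` has a periodic conjugacy class: some nontrivial `k ∈ K`
is conjugate to `αⁿ(k)` for a nonzero integer `n`. -/
def HasPeriodicConjugacyClass {K : Type*} [Group K] (α : MulAut K) : Prop :=
  ∃ (k : K) (n : ℤ) (c : K), k ≠ 1 ∧ n ≠ 0 ∧ (α ^ n) k = c * k * c⁻¹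
/-- A group is locally indicable if every nontrivial finitely generated subgroup
admits a surjective homomorphism onto `ℤ`. -/
def LocallyIndicable (K : Type*) [Group K] : Prop :=
  ∀ H : Subgroup K, H.FG → H ≠ ⊥ → ∃ f : ↥H →* Multiplicative ℤ, Function.Surjective f


section NumberTheory
open Polynomial

lemma aux_mahler_bound (D q : ℕ) (ν : ℤ[X]) (hm : ν.Monic) (hd : ν.natDegree ≤ D)
    (hr : ∀ z : ℂ, aeval z ν = 0 → ‖z‖ ^ q ≤ 2) :
    (ν.map (Int.castRingHom ℂ)).mahlerMeasure ^ q ≤ 2 ^ D := by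
  rw [mahlerMeasure_eq_leadingCoeff_mul_prod_roots]
  have hm' := hm.map (Int.castRingHom ℂ)
  rw [hm'.leadingCoeff, norm_one, one_mul, ← Multiset.prod_map_pow]
  have h1 : (Multiset.map (fun i : ℂ => (max 1 ‖i‖) ^ q) (ν.map (Int.castRingHom ℂ)).roots).prod
      ≤ 2 ^ (Multiset.card (ν.map (Int.castRingHom ℂ)).roots) := by
    have := Multiset.prod_map_le_prod_map₀ (s := (ν.map (Int.castRingHom ℂ)).roots)
      (fun i : ℂ => (max 1 ‖i‖) ^ q) (fun _ => (2 : ℝ)) (fun i _ => by positivity) ?_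
    · simpa using this
    · intro z hz
      rw [mem_roots hm'.ne_zero, IsRoot, eval_map, ← algebraMap_int_eq, ← aeval_def] at hz
      rcases max_cases 1 ‖z‖ with h | h
      · simp only [h.1, one_pow]; norm_num
      · simp only [h.1]; exact hr z hz
  refine h1.trans (pow_le_pow_right₀ (by norm_num) ?_)
  exact (card_roots' _).trans ((natDegree_map_le).trans hd)

/-- Uniform Kronecker type statement. -/
lemma exists_uniform_exponent (D : ℕ) : ∃ q : ℕ, 1 ≤ q ∧ ∀ z : ℂ, z ≠ 0 → ∀ P : ℤ[X], P ≠ 0 →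
    P.natDegree ≤ D → aeval z P = 0 → ∀ p : ℤ[X], p.Monic →
    (∀ y : ℂ, aeval y p = 0 → ‖y‖ ≤ 2) → aeval (z ^ q) p = 0 → ∃ k : ℕ, 0 < k ∧ z ^ k = 1 := by
  have hF := finite_mahlerMeasure_le D (2 ^ D)
  set F := {p : ℤ[X] | p.natDegree ≤ D ∧ (p.map (Int.castRingHom ℂ)).mahlerMeasure ≤ ((2 ^ D : NNReal) : ℝ)}
  have h1 : ∀ᶠ q : ℕ in atTop, ∀ p ∈ F, 1 < (p.map (Int.castRingHom ℂ)).mahlerMeasure →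
      (2 : ℝ) ^ D < (p.map (Int.castRingHom ℂ)).mahlerMeasure ^ q := by
    rw [eventually_all_finite hF]
    intro p _
    by_cases h : 1 < (p.map (Int.castRingHom ℂ)).mahlerMeasure
    · filter_upwards [(tendsto_pow_atTop_atTop_of_one_lt h).eventually_gt_atTop ((2 : ℝ) ^ D)] with q hq _
      exact hq
    · exact Eventually.of_forall fun q h' => absurd h' h
  obtain ⟨q, hq, hq1⟩ := (h1.and (eventually_ge_atTop 1)).exists
  refine ⟨q, hq1, fun z hz P hP hPd hPz p hp hpr hpz => ?_⟩
  have hIntegral : IsIntegral ℤ z := by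
    refine IsIntegral.of_pow (n := q) (by omega) ⟨p, hp, ?_⟩
    simpa [aeval_def] using hpz
  have hmon := minpoly.monic hIntegral
  have hdvd := minpoly.isIntegrallyClosed_dvd hIntegral hPz
  have hdeg : (minpoly ℤ z).natDegree ≤ D := (natDegree_le_of_dvd hdvd hP).trans hPd
  have hdvd2 : minpoly ℤ z ∣ expand ℤ q p := minpoly.isIntegrallyClosed_dvd hIntegral (by
    rw [expand_aeval]; exact hpz)
  have hb := aux_mahler_bound D q (minpoly ℤ z) hmon hdeg (fun y hy => by
    rw [← norm_pow]
    apply hpr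
    rw [← expand_aeval]
    exact aeval_eq_zero_of_dvd_aeval_eq_zero hdvd2 hy)
  have hge : 1 ≤ ((minpoly ℤ z).map (Int.castRingHom ℂ)).mahlerMeasure :=
    one_le_mahlerMeasure_of_ne_zero hmon.ne_zero
  have hmem : minpoly ℤ z ∈ F := by
    refine ⟨hdeg, ?_⟩
    push_cast
    exact (le_self_pow₀ hge (by omega)).trans hb
  have h1 : ((minpoly ℤ z).map (Int.castRingHom ℂ)).mahlerMeasure = 1 := by
    by_contra hne
    exact absurd (hq _ hmem (lt_of_le_of_ne hge (Ne.symm hne))) (not_lt.2 hb)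
  refine pow_eq_one_of_mahlerMeasure_eq_one h1 hz ?_
  rw [mem_aroots]
  exact ⟨hmon.ne_zero, minpoly.aeval _ _⟩

/-- Roots of a monic polynomial with other coefficients in `{-1,0,1}` have norm at most 2. -/
lemma norm_root_le_two (m : ℕ) (r : ℤ[X]) (hr : r.degree < m) (hc : ∀ i, |r.coeff i| ≤ 1) (y : ℂ)
    (hy : aeval y (X ^ m + r) = 0) : ‖y‖ ≤ 2 := by
  by_contra! h
  by_cases h0 : r = 0
  · subst h0
    simp only [map_pow, aeval_X, add_zero] at hy
    have : y = 0 := by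
      by_contra hne
      simp [hne] at hy
    rw [this] at h; norm_num at h
  have hdeg : r.natDegree < m := (natDegree_lt_iff_degree_lt h0).2 hr
  rw [map_add, map_pow, aeval_X, aeval_def, eval₂_eq_sum_range' _ hdeg] at hy
  · have h1 : ‖y‖ ^ m ≤ ∑ i ∈ Finset.range m, ‖y‖ ^ i := by
      rw [← norm_pow, eq_neg_of_add_eq_zero_left hy, norm_neg]
      refine (norm_sum_le _ _).trans (Finset.sum_le_sum fun i _ => ?_)
      rw [norm_mul, norm_pow]
      have : ‖(algebraMap ℤ ℂ) (r.coeff i)‖ ≤ 1 := by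
        simp only [algebraMap_int_eq, eq_intCast, Complex.norm_intCast]
        exact_mod_cast hc i
      nlinarith [pow_nonneg (norm_nonneg y) i]
    have h2 := geom_sum_mul ‖y‖ m
    have h3 : 0 < ‖y‖ ^ m := by positivity
    nlinarith [Finset.sum_nonneg (s := Finset.range m) (f := fun i => ‖y‖ ^ i) (fun i _ => by positivity)]

/-- Sequences killed by two polynomials in the shift: there is a common root. -/
lemma exists_common_root (P Q : ℤ[X]) (g : ℕ → ℤ) (hg : ∃ j, g j ≠ 0)
    (hP : ∀ j, P.sum (fun i a => a * g (i + j)) = 0)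
    (hQ : ∀ j, Q.sum (fun i a => a * g (i + j)) = 0) :
    ∃ z : ℂ, aeval z P = 0 ∧ aeval z Q = 0 := by
  by_contra! hcon
  let σ : Module.End ℂ (ℕ → ℂ) := LinearMap.funLeft ℂ ℂ Nat.succ
  have hσ : ∀ i (h : ℕ → ℂ) j, (σ ^ i) h j = h (i + j) := by
    intro i
    induction i with
    | zero => simp
    | succ i ih =>
      intro h j
      rw [pow_succ, Module.End.mul_apply, ih]
      simp only [σ, LinearMap.funLeft_apply]
      congr 1; omega
  have key : ∀ R : ℤ[X], (∀ j, R.sum (fun i a => a * g (i + j)) = 0) →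
      aeval σ (R.map (algebraMap ℤ ℂ)) (fun j => (g j : ℂ)) = 0 := by
    intro R hR
    ext j
    rw [aeval_map_algebraMap, aeval_def, eval₂_eq_sum, sum_def]
    have := congrArg (Int.cast : ℤ → ℂ) (hR j)
    rw [sum_def] at this
    push_cast at this
    simp only [LinearMap.sum_apply, Finset.sum_apply, Module.End.mul_apply, algebraMap_int_eq,
      eq_intCast, Pi.zero_apply]
    rw [← this]
    refine Finset.sum_congr rfl fun i _ => ?_
    rw [← zsmul_eq_mul, ← hσ i (fun j => (g j : ℂ)) j]
    simp [← Int.cast_smul_eq_zsmul ℂ]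
  have hcop : IsCoprime (P.map (algebraMap ℤ ℂ)) (Q.map (algebraMap ℤ ℂ)) := by
    rw [isCoprime_iff_aeval_ne_zero_of_isAlgClosed ℂ ℂ]
    intro a
    rw [aeval_map_algebraMap, aeval_map_algebraMap]
    by_cases h : aeval a P = 0
    · exact Or.inr (hcon a h)
    · exact Or.inl h
  obtain ⟨a, b, hab⟩ := hcop
  obtain ⟨j, hj⟩ := hg
  have := congrArg (fun R => aeval σ R (fun j => (g j : ℂ)) j) hab
  simp only [map_add, map_mul, LinearMap.add_apply, Module.End.mul_apply, key P hP, key Q hQ,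
    map_zero, map_one, Module.End.one_apply, add_zero, Pi.zero_apply] at this
  exact hj (by exact_mod_cast this.symm)

end NumberTheory

section Core
open Polynomial

lemma poly_induct {D : ℕ} {motive : ℤ[X] → Prop} (h0 : motive 0)
    (hadd : ∀ p q, motive p → motive q → motive (p + q))
    (hmon : ∀ i, i ≤ D → ∀ a : ℤ, motive (monomial i a)) (Q : ℤ[X]) (hQ : Q.natDegree ≤ D) :
    motive Q := by
  rw [as_sum_range' Q (D + 1) (by omega)]
  refine Finset.sum_induction _ motive hadd h0 fun i hi => hmon i ?_ _
  have := Finset.mem_range.1 hi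
  omega

lemma exists_evalHom {K : Type*} [Group K] (D n : ℕ) (hn : n ≤ D) (v : ℕ → K)
    (φ : Multiplicative (Fin n → ℤ) →* K) (hφ : ∀ i, i ≤ D → ∃ z, φ z = v i) :
    ∃ E : Multiplicative ℤ[X] →* K, (∀ i, i ≤ D → E (Multiplicative.ofAdd (X ^ i)) = v i) ∧
      ∃ P : ℤ[X], P ≠ 0 ∧ P.natDegree ≤ D ∧ E (Multiplicative.ofAdd P) = 1 := by
  choose! z hz using hφ
  let e : ℤ[X] →+ (Fin n → ℤ) :=
    { toFun := fun Q => ∑ i : Fin (D + 1), Q.coeff i • (z i).toAdd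
      map_zero' := by simp
      map_add' := fun p q => by simp [add_smul, Finset.sum_add_distrib] }
  have he : ∀ Q, e Q = ∑ i : Fin (D + 1), Q.coeff i • (z i).toAdd := fun _ => rfl
  refine ⟨φ.comp (AddMonoidHom.toMultiplicative e), ?_, ?_⟩
  · intro i hi
    rw [← hz i hi]
    have h1 : e (X ^ i) = (z i).toAdd := by
      rw [he, Finset.sum_eq_single (⟨i, by omega⟩ : Fin (D + 1))]
      · simp
      · intro b _ hb
        have : (b : ℕ) ≠ i := fun h => hb (Fin.ext h)
        simp [coeff_X_pow, this]
      · simp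
    simp [h1]
  · have hli : ¬ LinearIndependent ℤ (fun i : Fin (D + 1) => (z i).toAdd) := by
      intro h
      have := h.fintype_card_le_finrank
      simp at this
      omega
    rw [Fintype.not_linearIndependent_iff] at hli
    obtain ⟨g, hg, i, hi⟩ := hli
    have hc : ∀ j : Fin (D + 1), (∑ i : Fin (D + 1), monomial (i : ℕ) (g i)).coeff j = g j := by
      intro j
      rw [finsetSum_coeff, Finset.sum_eq_single j]
      · simp
      · intro b _ hb
        rw [coeff_monomial, if_neg]
        exact fun h => hb (Fin.ext h)
      · simp
    refine ⟨∑ i : Fin (D + 1), monomial (i : ℕ) (g i), ?_, ?_, ?_⟩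
    · intro h
      apply hi
      rw [← hc i, h, coeff_zero]
    · refine natDegree_sum_le_of_forall_le _ _ fun i _ => ?_
      refine (natDegree_monomial_le _).trans ?_
      omega
    · have : e (∑ i : Fin (D + 1), monomial (i : ℕ) (g i)) = 0 := by
        rw [he, ← hg]
        exact Finset.sum_congr rfl fun i _ => by rw [hc]
      simp [this]

lemma evalHom_monomial {K : Type*} [Group K] (E : Multiplicative ℤ[X] →* K) (i : ℕ) (a : ℤ) :
    E (Multiplicative.ofAdd (monomial i a)) = E (Multiplicative.ofAdd (X ^ i)) ^ a := by
  rw [← map_zpow, ← ofAdd_zsmul]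
  congr 2
  rw [← C_mul_X_pow_eq_monomial, zsmul_eq_mul]
  simp

lemma evalHom_shift {K : Type*} [Group K] (β : MulAut K) (D : ℕ) (v : K)
    (E : Multiplicative ℤ[X] →* K)
    (hE : ∀ i, i ≤ D → E (Multiplicative.ofAdd (X ^ i)) = (β ^ i) v) (Q : ℤ[X])
    (hQ : Q.natDegree < D) :
    β (E (Multiplicative.ofAdd Q)) = E (Multiplicative.ofAdd (X * Q)) := by
  refine poly_induct (D := D - 1) (motive := fun Q =>
    β (E (Multiplicative.ofAdd Q)) = E (Multiplicative.ofAdd (X * Q))) ?_ ?_ ?_ Q (by omega)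
  · simp
  · intro p q hp hq
    rw [ofAdd_add, map_mul, map_mul, hp, hq, ← map_mul, ← ofAdd_add, mul_add]
  · intro i hi a
    rw [X_mul_monomial, evalHom_monomial, evalHom_monomial, hE _ (by omega), hE _ (by omega),
      map_zpow, pow_succ', MulAut.mul_apply]

/-- The key cyclotomic step. -/
lemma root_not_unity {K : Type*} [Group K] (β : MulAut K) (D : ℕ) (v : K)
    (E : Multiplicative ℤ[X] →* K)
    (hE : ∀ i, i ≤ D → E (Multiplicative.ofAdd (X ^ i)) = (β ^ i) v)
    (hβ : ∀ k : ℕ, 0 < k → ∀ w, (β ^ k) w = w → w = 1)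
    (P : ℤ[X]) (hP0 : P ≠ 0) (hPD : P.natDegree ≤ D) (hP : E (Multiplicative.ofAdd P) = 1)
    (hmin : ∀ R : ℤ[X], R ≠ 0 → R.natDegree < P.natDegree → E (Multiplicative.ofAdd R) ≠ 1)
    (z : ℂ) (hz : aeval z P = 0) : z ≠ 0 ∧ ∀ k : ℕ, 0 < k → z ^ k ≠ 1 := by
  constructor
  · rintro rfl
    have : X ∣ P := by
      rw [X_dvd_iff]
      rw [aeval_def, eval₂_at_zero] at hz
      simpa using hz
    obtain ⟨R, rfl⟩ := this
    have hR0 : R ≠ 0 := right_ne_zero_of_mul hP0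
    have hd : (X * R).natDegree = R.natDegree + 1 := natDegree_X_mul hR0
    rw [← evalHom_shift β D v E hE R (by omega)] at hP
    exact hmin R hR0 (by omega) (by simpa using hP)
  · intro k hk hzk
    have hIntegral : IsIntegral ℤ z := IsIntegral.of_pow hk (by rw [hzk]; exact isIntegral_one)
    have hmon := minpoly.monic hIntegral
    have hpos := minpoly.natDegree_pos hIntegral
    obtain ⟨R, hR⟩ := minpoly.isIntegrallyClosed_dvd hIntegral hz
    have hk1 : minpoly ℤ z ∣ X ^ k - 1 :=
      minpoly.isIntegrallyClosed_dvd hIntegral (by simp [hzk])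
    set m := minpoly ℤ z
    have hR0 : R ≠ 0 := by rintro rfl; simp at hR; exact hP0 hR
    have hPd : P.natDegree = m.natDegree + R.natDegree := by
      rw [hR, natDegree_mul hmon.ne_zero hR0]
    have claim : ∀ j : ℕ, (β ^ j) (E (Multiplicative.ofAdd R)) =
        E (Multiplicative.ofAdd (R * (X ^ j %ₘ m))) := by
      intro j
      induction j with
      | zero =>
        have : (1 : ℤ[X]) %ₘ m = 1 := by
          rw [modByMonic_eq_self_iff hmon]
          rw [degree_one]
          exact natDegree_pos_iff_degree_pos.1 hpos
        simp [this]
      | succ j ih =>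
        rw [pow_succ', MulAut.mul_apply, ih]
        set Q := X ^ j %ₘ m with hQ
        have hQd : Q.natDegree < m.natDegree := natDegree_modByMonic_lt _ hmon (by
          intro h; rw [h] at hpos; simp at hpos)
        have hd1 : (R * Q).natDegree ≤ R.natDegree + Q.natDegree := natDegree_mul_le
        rw [evalHom_shift β D v E hE _ (by omega)]
        have e1 : X ^ (j + 1) %ₘ m = (X * Q) %ₘ m := by
          refine modByMonic_eq_of_dvd_sub hmon ?_
          have : m ∣ X ^ j - Q :=
            ⟨X ^ j /ₘ m, by rw [hQ, sub_eq_iff_eq_add', modByMonic_add_div]⟩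
          rw [pow_succ', ← mul_sub]
          exact this.mul_left _
        have e2 := modByMonic_add_div (X * Q) m
        have hc : ((X * Q) /ₘ m).natDegree = 0 := by
          rw [natDegree_divByMonic _ hmon]
          have : (X * Q).natDegree ≤ 1 + Q.natDegree := natDegree_mul_le.trans (by simp)
          omega
        rw [natDegree_eq_zero] at hc
        obtain ⟨a, ha⟩ := hc
        rw [e1]
        have e3 : X * (R * Q) = R * ((X * Q) %ₘ m) + a • P := by
          calc X * (R * Q) = R * (X * Q) := by ring
            _ = R * ((X * Q) %ₘ m + m * C a) := by rw [ha, e2]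
            _ = _ := by rw [hR, zsmul_eq_mul, eq_intCast C a]; ring
        rw [e3, ofAdd_add, map_mul, ofAdd_zsmul, map_zpow, hP, one_zpow, mul_one]
    have hkm : X ^ k %ₘ m = 1 := by
      have h1 : (1 : ℤ[X]) %ₘ m = 1 := by
        rw [modByMonic_eq_self_iff hmon]
        rw [degree_one]
        exact natDegree_pos_iff_degree_pos.1 hpos
      rw [← h1]
      exact modByMonic_eq_of_dvd_sub hmon hk1
    have := claim k
    rw [hkm, mul_one] at this
    exact hmin R hR0 (by omega) (hβ k hk _ this)

lemma li_functional {K : Type*} [Group K] (hLI : LocallyIndicable K) (H : Subgroup K) (hFG : H.FG)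
    (hne : H ≠ ⊥) : ∃ F : K → ℤ, (∀ x ∈ H, ∀ y ∈ H, F (x * y) = F x + F y) ∧ ∃ x ∈ H, F x ≠ 0 := by
  classical
  obtain ⟨f, hf⟩ := hLI H hFG hne
  refine ⟨fun x => if h : x ∈ H then (f ⟨x, h⟩).toAdd else 0, ?_, ?_⟩
  · intro x hx y hy
    simp only [hx, hy, H.mul_mem hx hy, dif_pos]
    rw [← toAdd_mul, ← map_mul]
    rfl
  · obtain ⟨x, hx⟩ := hf (Multiplicative.ofAdd 1)
    refine ⟨x, x.2, ?_⟩
    simp [hx]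

section Functional
variable {K : Type*} [Group K] {H : Subgroup K} {F : K → ℤ}

lemma fun_one (hF : ∀ x ∈ H, ∀ y ∈ H, F (x * y) = F x + F y) : F 1 = 0 := by
  have := hF 1 H.one_mem 1 H.one_mem
  rw [mul_one] at this
  omega

lemma fun_inv (hF : ∀ x ∈ H, ∀ y ∈ H, F (x * y) = F x + F y) (x : K) (hx : x ∈ H) : F x⁻¹ = - F x := by
  have := hF x hx x⁻¹ (H.inv_mem hx)
  rw [mul_inv_cancel, fun_one hF] at this
  omega

lemma fun_zpow (hF : ∀ x ∈ H, ∀ y ∈ H, F (x * y) = F x + F y) (x : K) (hx : x ∈ H) (a : ℤ) : F (x ^ a) = a * F x := by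
  induction a with
  | zero => simp [fun_one hF]
  | succ n ih =>
    rw [zpow_add, zpow_one, hF _ (H.zpow_mem hx _) _ hx, ih]; ring
  | pred n ih =>
    rw [zpow_sub, zpow_one, hF _ (H.zpow_mem hx _) _ (H.inv_mem hx), ih, fun_inv hF x hx]; ring

end Functional

/-- Words in the two elements. -/
def posWord {K : Type*} [Group K] (β : MulAut K) (q : ℕ) (v : K) : List Bool → K
  | [] => 1
  | b :: l => posWord β q v l * (β ^ (q * l.length)) (if b then v else 1)

/-- The associated polynomial. -/
noncomputable def posPoly : List Bool → ℤ[X]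
  | [] => 0
  | b :: l => posPoly l + (if b then X ^ l.length else 0)

lemma posPoly_degree (l : List Bool) : (posPoly l).degree < (l.length : ℕ) := by
  induction l with
  | nil => simp [posPoly]
  | cons b l ih =>
    rw [posPoly, List.length_cons]
    have h1 : ((l.length : ℕ) : WithBot ℕ) < ((l.length + 1 : ℕ) : WithBot ℕ) := by
      exact_mod_cast Nat.lt_succ_self _
    refine lt_of_le_of_lt (degree_add_le _ _) (max_lt (ih.trans h1) ?_)
    cases b
    · simp
    · simpa using h1

lemma posPoly_coeff (l : List Bool) (i : ℕ) : (posPoly l).coeff i = 0 ∨ (posPoly l).coeff i = 1 := by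
  induction l with
  | nil => simp [posPoly]
  | cons b l ih =>
    rw [posPoly, coeff_add]
    cases b
    · simpa using ih
    · by_cases h : i = l.length
      · have := coeff_eq_zero_of_degree_lt (posPoly_degree l)
        subst h
        simp [this]
      · simpa [coeff_X_pow, h] using ih

/-- `∑ Q_i g_{i+j}`. -/
noncomputable def shiftSum (g : ℕ → ℤ) (j : ℕ) (Q : ℤ[X]) : ℤ := Q.sum (fun i a => a * g (i + j))

lemma shiftSum_add (g : ℕ → ℤ) (j : ℕ) (p q : ℤ[X]) :
    shiftSum g j (p + q) = shiftSum g j p + shiftSum g j q := by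
  unfold shiftSum
  rw [sum_add_index] <;> intros <;> ring

lemma shiftSum_monomial (g : ℕ → ℤ) (j i : ℕ) (a : ℤ) :
    shiftSum g j (monomial i a) = a * g (i + j) := by
  unfold shiftSum
  rw [sum_monomial_index]
  ring

lemma shiftSum_zero (g : ℕ → ℤ) (j : ℕ) : shiftSum g j 0 = 0 := by simp [shiftSum]

lemma shiftSum_X_pow (g : ℕ → ℤ) (j i : ℕ) :
    shiftSum g j (X ^ i) = g (i + j) := by
  rw [X_pow_eq_monomial, shiftSum_monomial, one_mul]

/-- The contradiction: last letters differ. -/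
lemma core_contra {K : Type*} [Group K] (hLI : LocallyIndicable K) (β : MulAut K) (D n q : ℕ)
    (hn : n ≤ D) (hq1 : 1 ≤ q)
    (hq : ∀ z : ℂ, z ≠ 0 → ∀ P : ℤ[X], P ≠ 0 →
      P.natDegree ≤ D → aeval z P = 0 → ∀ p : ℤ[X], p.Monic →
      (∀ y : ℂ, aeval y p = 0 → ‖y‖ ≤ 2) → aeval (z ^ q) p = 0 → ∃ k : ℕ, 0 < k ∧ z ^ k = 1)
    (v : K) (hv : v ≠ 1) (φ : Multiplicative (Fin n → ℤ) →* K)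
    (hφ : ∀ i, i ≤ D → ∃ z, φ z = (β ^ i) v)
    (hβ : ∀ k : ℕ, 0 < k → ∀ w, (β ^ k) w = w → w = 1)
    (l l' : List Bool) (hl : l.length = l'.length)
    (h : posWord β q v (true :: l) = posWord β q v (false :: l')) : False := by
  obtain ⟨E, hE, P', hP'0, hP'D, hP'⟩ := exists_evalHom D n hn (fun i => (β ^ i) v) φ hφ
  -- minimal polynomial
  obtain ⟨P, hP0, hPD, hP, hmin⟩ : ∃ P : ℤ[X], P ≠ 0 ∧ P.natDegree ≤ D ∧
      E (Multiplicative.ofAdd P) = 1 ∧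
      ∀ R : ℤ[X], R ≠ 0 → R.natDegree < P.natDegree → E (Multiplicative.ofAdd R) ≠ 1 := by
    classical
    have hex : ∃ r, ∃ P : ℤ[X], P ≠ 0 ∧ P.natDegree = r ∧ E (Multiplicative.ofAdd P) = 1 :=
      ⟨_, P', hP'0, rfl, hP'⟩
    obtain ⟨P, hP0, hPr, hP⟩ := Nat.find_spec hex
    refine ⟨P, hP0, ?_, hP, fun R hR0 hRd hR => ?_⟩
    · rw [hPr]
      exact (Nat.find_min' hex ⟨P', hP'0, rfl, hP'⟩).trans hP'D
    · rw [hPr] at hRd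
      exact Nat.find_min hex hRd ⟨R, hR0, rfl, hR⟩
  clear hP' hP'D hP'0 P'
  set m := l.length with hm
  set N := q * m with hN
  let H : Subgroup K := Subgroup.closure ((fun i : ℕ => (β ^ i) v) '' (Finset.range N : Set ℕ))
  have hgen : ∀ i, i < N → (β ^ i) v ∈ H := fun i hi =>
    Subgroup.subset_closure ⟨i, by simpa using hi, rfl⟩
  have hword : ∀ l0 : List Bool, l0.length ≤ m → posWord β q v l0 ∈ H := by
    intro l0
    induction l0 with
    | nil => intro _; exact H.one_mem
    | cons b l0 ih =>
      intro hlen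
      rw [List.length_cons] at hlen
      rw [posWord]
      refine H.mul_mem (ih (by omega)) ?_
      cases b
      · simp [H.one_mem]
      · simp only [if_true]
        exact hgen _ (Nat.mul_lt_mul_of_pos_left (by omega) (by omega))
  have hvN : (β ^ N) v ∈ H := by
    have h2 : (β ^ N) v = (posWord β q v l)⁻¹ * posWord β q v l' := by
      have h' := h
      rw [posWord, posWord] at h'
      simp only [if_true, Bool.false_eq_true, if_false, map_one, mul_one] at h'
      rw [← h']
      group
      rfl
    rw [h2]
    exact H.mul_mem (H.inv_mem (hword l le_rfl)) (hword l' (by omega))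
  have hstab : ∀ x ∈ H, β x ∈ H := by
    intro x hx
    have : H ≤ H.comap β.toMonoidHom := by
      refine (Subgroup.closure_le _).2 ?_
      rintro _ ⟨i, hi, rfl⟩
      have hi' : i < N := by simpa using hi
      change β ((β ^ i) v) ∈ H
      rw [← MulAut.mul_apply, ← pow_succ']
      rcases Nat.lt_or_ge (i + 1) N with h3 | h3
      · exact hgen _ h3
      · rw [show i + 1 = N by omega]; exact hvN
    exact this hx
  have hstab' : ∀ j : ℕ, ∀ x ∈ H, (β ^ j) x ∈ H := by
    intro j
    induction j with
    | zero => intro x hx; simpa using hx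
    | succ j ih =>
      intro x hx
      rw [pow_succ', MulAut.mul_apply]
      exact hstab _ (ih x hx)
  have hall : ∀ j : ℕ, (β ^ j) v ∈ H := by
    intro j
    rcases Nat.lt_or_ge j N with h3 | h3
    · exact hgen j h3
    · obtain ⟨k, rfl⟩ := Nat.exists_eq_add_of_le h3
      rw [add_comm, pow_add, MulAut.mul_apply]
      exact hstab' k _ hvN
  have hne : H ≠ ⊥ := by
    intro hb
    have := hall 0
    rw [hb, Subgroup.mem_bot] at this
    exact hv (by simpa using this)
  have hFG : H.FG := by
    rw [Subgroup.fg_iff]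
    exact ⟨_, rfl, (Finset.finite_toSet _).image _⟩
  obtain ⟨F, hF, x, hx, hFx⟩ := li_functional hLI H hFG hne
  let g : ℕ → ℤ := fun j => F ((β ^ j) v)
  have hg : ∃ j, g j ≠ 0 := by
    by_contra! hg0
    apply hFx
    refine Subgroup.closure_induction (p := fun y _ => F y = 0) ?_ ?_ ?_ ?_ hx
    · rintro _ ⟨i, _, rfl⟩
      exact hg0 i
    · exact fun_one hF
    · intro a b ha hb h1 h2
      rw [hF a ha b hb, h1, h2, add_zero]
    · intro a ha h1
      rw [fun_inv hF a ha, h1, neg_zero]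
  have hFE : ∀ j : ℕ, ∀ Q : ℤ[X], Q.natDegree ≤ D → (β ^ j) (E (Multiplicative.ofAdd Q)) ∈ H ∧
      F ((β ^ j) (E (Multiplicative.ofAdd Q))) = shiftSum g j Q := by
    intro j Q hQ
    refine poly_induct (D := D) (motive := fun Q => (β ^ j) (E (Multiplicative.ofAdd Q)) ∈ H ∧
      F ((β ^ j) (E (Multiplicative.ofAdd Q))) = shiftSum g j Q) ?_ ?_ ?_ Q hQ
    · simp [H.one_mem, fun_one hF, shiftSum_zero]
    · rintro p q ⟨hp1, hp2⟩ ⟨hq1, hq2⟩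
      rw [ofAdd_add, map_mul, map_mul, hF _ hp1 _ hq1, hp2, hq2, shiftSum_add]
      exact ⟨H.mul_mem hp1 hq1, rfl⟩
    · intro i hi a
      rw [evalHom_monomial, hE i hi, map_zpow, ← MulAut.mul_apply, ← pow_add,
        fun_zpow hF _ (hall _), shiftSum_monomial, add_comm j i]
      exact ⟨H.zpow_mem (hall _) _, rfl⟩
  have hFW : ∀ j : ℕ, ∀ l0 : List Bool, (β ^ j) (posWord β q v l0) ∈ H ∧
      F ((β ^ j) (posWord β q v l0)) = shiftSum g j (expand ℤ q (posPoly l0)) := by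
    intro j l0
    induction l0 with
    | nil => simp [posWord, posPoly, H.one_mem, fun_one hF, shiftSum_zero]
    | cons b l0 ih =>
      rw [posWord, posPoly, map_add, shiftSum_add, map_mul]
      cases b
      · simpa [shiftSum_zero] using ih
      · simp only [if_true, map_pow, expand_X]
        rw [← MulAut.mul_apply, ← pow_add, hF _ ih.1 _ (hall _), ih.2, ← pow_mul, shiftSum_X_pow,
          add_comm j]
        exact ⟨H.mul_mem ih.1 (hall _), rfl⟩
  set r : ℤ[X] := posPoly l - posPoly l' with hr
  have hrdeg : r.degree < (m : ℕ) := by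
    refine lt_of_le_of_lt (degree_sub_le _ _) (max_lt (posPoly_degree l) ?_)
    rw [hl]; exact posPoly_degree l'
  have hrc : ∀ i, |r.coeff i| ≤ 1 := by
    intro i
    rw [hr, coeff_sub]
    rcases posPoly_coeff l i with h1 | h1 <;> rcases posPoly_coeff l' i with h2 | h2 <;>
      simp [h1, h2]
  have hQ : ∀ j, shiftSum g j (expand ℤ q (X ^ m + r)) = 0 := by
    intro j
    have e1 := (hFW j (true :: l)).2
    have e2 := (hFW j (false :: l')).2
    rw [h, e2] at e1
    have e3 : posPoly (true :: l) = (X ^ m + r) + posPoly (false :: l') := by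
      simp only [posPoly, if_true, Bool.false_eq_true, if_false, hr]
      ring
    rw [e3, map_add, shiftSum_add] at e1
    omega
  have hPs : ∀ j, shiftSum g j P = 0 := by
    intro j
    rw [← (hFE j P hPD).2, hP, map_one, fun_one hF]
  obtain ⟨z, hz1, hz2⟩ := exists_common_root P (expand ℤ q (X ^ m + r)) g hg hPs hQ
  obtain ⟨hz0, hzk⟩ := root_not_unity β D v E hE hβ P hP0 hPD hP hmin z hz1
  rw [expand_aeval] at hz2
  obtain ⟨k, hk, hk1⟩ := hq z hz0 P hP0 hPD hz1 (X ^ m + r) (monic_X_pow_add hrdeg)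
    (norm_root_le_two m r hrdeg hrc) hz2
  exact hzk k hk hk1

lemma core {K : Type*} [Group K] (hLI : LocallyIndicable K) (β : MulAut K) (D n q : ℕ)
    (hn : n ≤ D) (hq1 : 1 ≤ q)
    (hq : ∀ z : ℂ, z ≠ 0 → ∀ P : ℤ[X], P ≠ 0 →
      P.natDegree ≤ D → aeval z P = 0 → ∀ p : ℤ[X], p.Monic →
      (∀ y : ℂ, aeval y p = 0 → ‖y‖ ≤ 2) → aeval (z ^ q) p = 0 → ∃ k : ℕ, 0 < k ∧ z ^ k = 1)
    (v : K) (hv : v ≠ 1) (φ : Multiplicative (Fin n → ℤ) →* K)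
    (hφ : ∀ i, i ≤ D → ∃ z, φ z = (β ^ i) v)
    (hβ : ∀ k : ℕ, 0 < k → ∀ w, (β ^ k) w = w → w = 1) :
    ∀ l l' : List Bool, l.length = l'.length → posWord β q v l = posWord β q v l' → l = l' := by
  intro l
  induction l with
  | nil =>
    intro l' hl _
    exact (List.length_eq_zero_iff.1 hl.symm).symm
  | cons b l ih =>
    intro l' hl h
    cases l' with
    | nil => simp at hl
    | cons b' l' =>
      have hl' : l.length = l'.length := by simpa using hl
      cases b <;> cases b'
      · rw [posWord, posWord] at h
        simp only [Bool.false_eq_true, if_false, map_one, mul_one] at h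
        rw [ih l' hl' h]
      · exact (core_contra hLI β D n q hn hq1 hq v hv φ hφ hβ l' l hl'.symm h.symm).elim
      · exact (core_contra hLI β D n q hn hq1 hq v hv φ hφ hβ l l' hl' h).elim
      · rw [posWord, posWord, hl'] at h
        rw [ih l' hl' (mul_right_cancel h)]

end Core

section Growth

lemma wordBall_subset_pow {G : Type*} [Group G] (S : Finset G) : ∃ T : Finset G, T.Nonempty ∧
    ∀ n, (wordBall S n).Finite ∧ (wordBall S n).ncard ≤ T.card ^ n := by
  classical
  open scoped Pointwise in
  let T : Finset G := S ∪ S⁻¹ ∪ {1}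
  have h1 : (1 : G) ∈ T := by simp [T]
  refine ⟨T, ⟨1, h1⟩, fun n => ?_⟩
  open scoped Pointwise in
  have hsub : wordBall S n ⊆ ((T ^ n : Finset G) : Set G) := by
    rintro g ⟨l, hl, hmem, rfl⟩
    have h2 : ∀ l : List G, (∀ x ∈ l, x ∈ S ∨ x⁻¹ ∈ S) → l.prod ∈ T ^ l.length := by
      intro l
      induction l with
      | nil => intro _; simp
      | cons a l ih =>
        intro h
        rw [List.prod_cons, List.length_cons, pow_succ']
        refine Finset.mul_mem_mul ?_ (ih fun x hx => h x (List.mem_cons_of_mem _ hx))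
        have := h a List.mem_cons_self
        simp only [T, Finset.mem_union, Finset.mem_inv', Finset.mem_singleton]
        tauto
    exact Finset.pow_subset_pow_right h1 hl (h2 l hmem)
  refine ⟨(Finset.finite_toSet _).subset hsub, ?_⟩
  have h3 := Set.ncard_le_ncard hsub (Finset.finite_toSet _)
  rw [Set.ncard_coe_finset] at h3
  exact h3.trans Finset.card_pow_le

lemma wordBall_finite {G : Type*} [Group G] (S : Finset G) (n : ℕ) : (wordBall S n).Finite := by
  obtain ⟨T, _, hT⟩ := wordBall_subset_pow S
  exact (hT n).1

lemma growth_bdd {G : Type*} [Group G] (S : Finset G) :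
    IsBoundedUnder (· ≤ ·) atTop (fun n : ℕ => ((wordBall S n).ncard : ℝ) ^ (1 / (n : ℝ))) := by
  obtain ⟨T, hT0, hT⟩ := wordBall_subset_pow S
  refine isBoundedUnder_of ⟨max 1 (T.card : ℝ), fun n => ?_⟩
  rcases Nat.eq_zero_or_pos n with rfl | hn
  · simp
  · refine le_max_of_le_right ?_
    have h1 : ((wordBall S n).ncard : ℝ) ≤ (T.card : ℝ) ^ n := by exact_mod_cast (hT n).2
    calc ((wordBall S n).ncard : ℝ) ^ (1 / (n : ℝ)) ≤ ((T.card : ℝ) ^ n) ^ (1 / (n : ℝ)) :=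
          Real.rpow_le_rpow (by positivity) h1 (by positivity)
      _ = T.card := by
          rw [one_div]
          exact Real.pow_rpow_inv_natCast (by positivity) (by omega)

lemma growthRate_nonneg {G : Type*} [Group G] (S : Finset G) : 0 ≤ growthRate S :=
  le_limsup_of_frequently_le (Eventually.of_forall fun n => by positivity).frequently (growth_bdd S)

lemma le_growthRate {G : Type*} [Group G] (S : Finset G) (C : ℕ) (hC : 1 ≤ C) (x : ℝ) (hx : 0 ≤ x)
    (h : ∃ᶠ n : ℕ in atTop, x ^ n ≤ ((wordBall S (C * n)).ncard : ℝ)) :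
    x ^ (1 / (C : ℝ)) ≤ growthRate S := by
  refine le_limsup_of_frequently_le ?_ (growth_bdd S)
  rw [frequently_atTop] at h ⊢
  intro a
  obtain ⟨n, hn, hn2⟩ := h (max a 1)
  have hn1 : 1 ≤ n := (le_max_right _ _).trans hn
  refine ⟨C * n, ?_, ?_⟩
  · have := (le_max_left a 1).trans hn
    nlinarith
  · have hn' : (n : ℝ) ≠ 0 := by positivity
    have hC' : (C : ℝ) ≠ 0 := by positivity
    calc x ^ (1 / (C : ℝ)) = (x ^ n) ^ (1 / ((C * n : ℕ) : ℝ)) := by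
          rw [← Real.rpow_natCast, ← Real.rpow_mul hx]
          congr 1
          push_cast
          field_simp
      _ ≤ _ := Real.rpow_le_rpow (by positivity) hn2 (by positivity)

lemma wordBall_mono {G : Type*} [Group G] (S : Finset G) {a b : ℕ} (h : a ≤ b) :
    wordBall S a ⊆ wordBall S b := fun _ ⟨l, hl, h2⟩ => ⟨l, hl.trans h, h2⟩

lemma wordBall_mul {G : Type*} [Group G] (S : Finset G) {a b : ℕ} {x y : G}
    (hx : x ∈ wordBall S a) (hy : y ∈ wordBall S b) : x * y ∈ wordBall S (a + b) := by
  obtain ⟨l, hl, h1, rfl⟩ := hx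
  obtain ⟨l', hl', h1', rfl⟩ := hy
  refine ⟨l ++ l', by simp; omega, ?_, by simp⟩
  intro x hx
  rcases List.mem_append.1 hx with h | h
  · exact h1 x h
  · exact h1' x h

lemma wordBall_one {G : Type*} [Group G] (S : Finset G) (n : ℕ) : (1 : G) ∈ wordBall S n :=
  ⟨[], by simp, by simp, by simp⟩

lemma wordBall_gen {G : Type*} [Group G] (S : Finset G) {x : G} (hx : x ∈ S) :
    x ∈ wordBall S 1 := ⟨[x], by simp, by simp [hx], by simp⟩

lemma wordBall_inv {G : Type*} [Group G] (S : Finset G) {a : ℕ} {x : G}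
    (hx : x ∈ wordBall S a) : x⁻¹ ∈ wordBall S a := by
  obtain ⟨l, hl, h1, rfl⟩ := hx
  refine ⟨(l.map (·⁻¹)).reverse, by simpa using hl, ?_, by rw [List.prod_inv_reverse]⟩
  intro x hx
  simp only [List.mem_reverse, List.mem_map] at hx
  obtain ⟨y, hy, rfl⟩ := hx
  rw [inv_inv]
  exact (h1 y hy).symm

lemma wordBall_pow {G : Type*} [Group G] (S : Finset G) {a : ℕ} {x : G}
    (hx : x ∈ wordBall S a) (n : ℕ) : x ^ n ∈ wordBall S (n * a) := by
  induction n with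
  | zero => simpa using wordBall_one S _
  | succ n ih =>
    rw [pow_succ, Nat.succ_mul]
    exact wordBall_mul S ih hx

/-- A subgroup of uniform growth generated by short elements. -/
lemma growth_of_subgroup {K G : Type*} [Group K] [Group G] (ι : K →* G) (hι : Function.Injective ι)
    (S : Finset G) (T : Finset K) (L : ℕ) (hL : 1 ≤ L) (hT : ∀ x ∈ T, ι x ∈ wordBall S L)
    (u : ℝ) (hu : 1 < u)
    (hH : u ≤ growthOmega ↥(Subgroup.closure (T : Set K))) :
    ((1 + u) / 2) ^ (1 / (L : ℝ)) ≤ growthRate S := by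
  classical
  set H := Subgroup.closure (T : Set K) with hHdef
  let T' : Finset H := T.attach.image (fun x => ⟨x.1, Subgroup.subset_closure x.2⟩)
  have hT'mem : ∀ x ∈ T', (x : K) ∈ T := by
    intro x hx
    simp only [T', Finset.mem_image, Finset.mem_attach, true_and, Subtype.exists] at hx
    obtain ⟨y, hy, rfl⟩ := hx
    exact hy
  have hT'gen : Subgroup.closure (T' : Set H) = ⊤ := by
    rw [← Subgroup.closure_closure_coe_preimage (k := (T : Set K))]
    congr 1
    ext x
    simp only [T', Finset.coe_image, Set.mem_image, Set.mem_preimage, Finset.mem_coe,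
      Finset.mem_attach, true_and, Subtype.exists]
    constructor
    · rintro ⟨y, hy, rfl⟩; exact hy
    · intro hx; exact ⟨x, hx, rfl⟩
  have h1 : u ≤ growthRate T' := by
    refine hH.trans (csInf_le ⟨0, ?_⟩ ⟨T', hT'gen, rfl⟩)
    rintro _ ⟨S', _, rfl⟩
    exact growthRate_nonneg S'
  have h2 : ∃ᶠ n : ℕ in atTop, (1 + u) / 2 < ((wordBall T' n).ncard : ℝ) ^ (1 / (n : ℝ)) := by
    refine frequently_lt_of_lt_limsup ?_ (lt_of_lt_of_le (by linarith) h1)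
    exact isCoboundedUnder_le_of_le atTop (x := 0) (fun n => by positivity)
  refine le_growthRate S L hL _ (by linarith) ?_
  refine (h2.and_eventually (eventually_ge_atTop 1)).mono ?_
  rintro n ⟨hn, hn1⟩
  have h3 : ((1 + u) / 2) ^ n ≤ ((wordBall T' n).ncard : ℝ) := by
    calc ((1 + u) / 2) ^ n ≤ (((wordBall T' n).ncard : ℝ) ^ (1 / (n : ℝ))) ^ n :=
          pow_le_pow_left₀ (by linarith) hn.le n
      _ = _ := by
          rw [one_div]
          exact Real.rpow_inv_natCast_pow (by positivity) (by omega)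
  refine h3.trans ?_
  have h4 : (wordBall T' n).ncard ≤ (wordBall S (L * n)).ncard := by
    refine Set.ncard_le_ncard_of_injOn (fun x : H => ι (x : K)) ?_ ?_ (wordBall_finite S _)
    · rintro _ ⟨l, hl, hmem, rfl⟩
      refine wordBall_mono S (Nat.mul_le_mul_left L hl) ?_
      clear hl
      induction l with
      | nil => simpa using wordBall_one S _
      | cons a l ih =>
        rw [List.prod_cons, List.length_cons, Nat.mul_succ, add_comm]
        rw [Subgroup.coe_mul, map_mul]
        refine wordBall_mul S ?_ (ih fun x hx => hmem x (List.mem_cons_of_mem _ hx))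
        rcases hmem a List.mem_cons_self with h | h
        · exact hT _ (hT'mem _ h)
        · have := wordBall_inv S (hT _ (hT'mem _ h))
          simpa using this
    · intro x _ y _ hxy
      exact Subtype.ext (hι hxy)
  exact_mod_cast h4

end Growth

section Klein

lemma klein_squares : ∃ ψ : Multiplicative (Fin 2 → ℤ) →* KleinBottleGroup,
    ∀ x : KleinBottleGroup, ∃ z, ψ z = x ^ 2 := by
  let a : KleinBottleGroup := PresentedGroup.of 0
  let t : KleinBottleGroup := PresentedGroup.of 1
  have hrel : t * a * t⁻¹ * a = 1 :=
    PresentedGroup.one_of_mem (rels := kleinBottleRels) (Set.mem_singleton _)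
  have hta : t * a * t⁻¹ = a⁻¹ := eq_inv_of_mul_eq_one_left hrel
  have hconj : ∀ i : ℤ, t * a ^ i * t⁻¹ = a ^ (-i) := by
    intro i
    rw [← conj_zpow, hta, inv_zpow, zpow_neg]
  have hta' : ∀ i : ℤ, t * a ^ i = a ^ (-i) * t := by
    intro i
    rw [← hconj]; group
  have hta'' : ∀ i : ℤ, t⁻¹ * a ^ i = a ^ (-i) * t⁻¹ := by
    intro i
    have := hta' (-i)
    rw [neg_neg] at this
    rw [inv_mul_eq_iff_eq_mul, ← mul_assoc, this]; group
  have hcomm : Commute a (t ^ 2) := by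
    have h1 := hta' 1
    have h2 := hta' (-1)
    rw [neg_neg] at h2
    rw [zpow_one] at h1 h2
    change a * t ^ 2 = t ^ 2 * a
    rw [pow_two, mul_assoc, h1, ← mul_assoc t, h2, mul_assoc]
  have hnf : ∀ x : KleinBottleGroup, ∃ i j : ℤ, x = a ^ i * t ^ j := by
    intro x
    have hx : x ∈ Subgroup.closure (Set.range (PresentedGroup.of (rels := kleinBottleRels))) := by
      rw [PresentedGroup.closure_range_of]; trivial
    refine Subgroup.closure_induction_left (p := fun x _ => ∃ i j : ℤ, x = a ^ i * t ^ j)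
      ⟨0, 0, by simp⟩ ?_ ?_ hx
    · rintro _ ⟨k, rfl⟩ y _ ⟨i, j, rfl⟩
      fin_cases k
      · refine ⟨1 + i, j, ?_⟩
        change a * _ = _
        rw [zpow_add, zpow_one, mul_assoc]
      · refine ⟨-i, 1 + j, ?_⟩
        change t * _ = _
        rw [← mul_assoc, hta', zpow_add, zpow_one, mul_assoc]
    · rintro _ ⟨k, rfl⟩ y _ ⟨i, j, rfl⟩
      fin_cases k
      · refine ⟨-1 + i, j, ?_⟩
        change a⁻¹ * _ = _
        rw [zpow_add, zpow_neg_one, mul_assoc]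
      · refine ⟨-i, -1 + j, ?_⟩
        change t⁻¹ * _ = _
        rw [← mul_assoc, hta'', zpow_add, zpow_neg_one, mul_assoc]
  refine ⟨MonoidHom.mk' (fun z => a ^ (z.toAdd 0) * (t ^ 2) ^ (z.toAdd 1)) ?_, ?_⟩
  · intro y z
    simp only [toAdd_mul, Pi.add_apply, zpow_add]
    have := (hcomm.zpow_zpow (z.toAdd 0) (y.toAdd 1)).eq
    simp only [mul_assoc]
    congr 1
    simp only [← mul_assoc]
    rw [this]
  · intro x
    obtain ⟨i, j, rfl⟩ := hnf x
    have hc2 : ∀ j i : ℤ, Commute ((t ^ 2) ^ j) (a ^ i) := fun j i => (hcomm.zpow_zpow i j).symm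
    rcases Int.even_or_odd' j with ⟨m, rfl | rfl⟩
    · refine ⟨Multiplicative.ofAdd ![2 * i, 2 * m], ?_⟩
      have e : t ^ (2 * m) = (t ^ 2) ^ m := by rw [zpow_mul]; rfl
      simp only [MonoidHom.mk'_apply, toAdd_ofAdd, Matrix.cons_val_zero, Matrix.cons_val_one]
      rw [e, (hc2 m i).symm.mul_pow, mul_comm 2 i, mul_comm 2 m, zpow_mul, zpow_mul]
      rfl
    · refine ⟨Multiplicative.ofAdd ![0, 2 * m + 1], ?_⟩
      have e : t ^ (2 * m + 1) = (t ^ 2) ^ m * t := by rw [zpow_add, zpow_mul, zpow_one]; rfl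
      have h3 := (hc2 m (-i)).eq
      simp only [MonoidHom.mk'_apply, toAdd_ofAdd, Matrix.cons_val_zero, Matrix.cons_val_one]
      have h4 : t * (t ^ 2) ^ m = (t ^ 2) ^ m * t :=
        (((Commute.refl t).pow_right 2).zpow_right m).eq
      rw [e, zpow_zero, one_mul]
      calc (t ^ 2) ^ (2 * m + 1) = (t ^ 2) ^ m * (t ^ 2) ^ m * (t * t) := by
            rw [← pow_two t, two_mul, zpow_add, zpow_add, zpow_one]
        _ = (t ^ 2) ^ m * (t * (t ^ 2) ^ m) * t := by rw [h4]; simp only [mul_assoc]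
        _ = a ^ i * (a ^ (-i) * (t ^ 2) ^ m) * (t * (t ^ 2) ^ m) * t := by
            rw [← mul_assoc (a ^ i), ← zpow_add]; simp
        _ = a ^ i * (t ^ 2) ^ m * (a ^ (-i) * t) * (t ^ 2) ^ m * t := by
            rw [← h3]; simp only [mul_assoc]
        _ = (a ^ i * ((t ^ 2) ^ m * t)) ^ 2 := by
            rw [← hta', pow_two (a ^ i * _)]; simp only [mul_assoc]

end Klein

section Final

variable {K : Type*} [Group K]

lemma zSemidirect_fg (hK : Group.FG K) (α : MulAut K) : Group.FG (zSemidirect K α) := by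
  classical
  obtain ⟨S, hS⟩ := hK.out
  refine ⟨⟨S.image (SemidirectProduct.inl : K →* zSemidirect K α) ∪
    {SemidirectProduct.inr (Multiplicative.ofAdd 1)}, ?_⟩⟩
  rw [eq_top_iff]
  intro x _
  rw [← SemidirectProduct.inl_left_mul_inr_right x]
  refine Subgroup.mul_mem _ ?_ ?_
  · have h1 : x.left ∈ Subgroup.closure (S : Set K) := by rw [hS]; trivial
    have h2 := Subgroup.mem_map_of_mem (SemidirectProduct.inl : K →* zSemidirect K α) h1
    rw [MonoidHom.map_closure] at h2
    refine Subgroup.closure_mono ?_ h2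
    intro y hy
    simp only [Finset.coe_union, Finset.coe_image]
    exact Or.inl hy
  · have : x.right = (Multiplicative.ofAdd (1 : ℤ)) ^ (x.right.toAdd) := by
      rw [← ofAdd_zsmul]; simp
    rw [this, map_zpow]
    refine Subgroup.zpow_mem _ (Subgroup.subset_closure ?_) _
    simp

lemma conj_inl (α : MulAut K) (y : zSemidirect K α) (x : K) :
    y * SemidirectProduct.inl x * y⁻¹ =
      SemidirectProduct.inl (y.left * (α ^ y.right.toAdd) x * y.left⁻¹) := by
  have h1 : (SemidirectProduct.inl ((α ^ y.right.toAdd) x) : zSemidirect K α) =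
      SemidirectProduct.inr y.right * SemidirectProduct.inl x * SemidirectProduct.inr y.right⁻¹ :=
    SemidirectProduct.inl_aut (φ := zAction α) y.right x
  rw [map_mul, map_mul, h1, map_inv, map_inv]
  conv_lhs => rw [← SemidirectProduct.inl_left_mul_inr_right y]
  group

lemma exists_noncomm [Nontrivial K] (α : MulAut K) (hα : ¬ HasPeriodicConjugacyClass α)
    (S : Finset (zSemidirect K α)) (hS : Subgroup.closure (S : Set (zSemidirect K α)) = ⊤) :
    ∃ a ∈ S, ∃ b ∈ S, a * b ≠ b * a := by
  by_contra! hcon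
  have h1 : Subgroup.closure (S : Set (zSemidirect K α)) ≤ Subgroup.centralizer S := by
    refine (Subgroup.closure_le _).2 fun a ha => ?_
    rw [SetLike.mem_coe, Subgroup.mem_centralizer_iff]
    intro b hb
    exact hcon b hb a ha
  have h2 : Subgroup.closure (S : Set (zSemidirect K α)) ≤ Subgroup.centralizer Set.univ := by
    refine (Subgroup.closure_le _).2 fun a ha => ?_
    rw [SetLike.mem_coe, Subgroup.mem_centralizer_iff]
    intro b _
    have hb : b ∈ Subgroup.centralizer (S : Set (zSemidirect K α)) := h1 (by rw [hS]; trivial)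
    exact (Subgroup.mem_centralizer_iff.1 hb a ha).symm
  obtain ⟨x, hx⟩ := exists_ne (1 : K)
  have h3 : (SemidirectProduct.inl x : zSemidirect K α) ∈ Subgroup.centralizer Set.univ :=
    h2 (by rw [hS]; trivial)
  have h4 := Subgroup.mem_centralizer_iff.1 h3
    (SemidirectProduct.inr (Multiplicative.ofAdd 1)) (Set.mem_univ _)
  have h5 := conj_inl α (SemidirectProduct.inr (Multiplicative.ofAdd 1)) x
  rw [h4, mul_inv_cancel_right] at h5
  have h6 := SemidirectProduct.inl_injective h5
  refine hα ⟨x, 1, 1, hx, one_ne_zero, ?_⟩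
  simpa using h6.symm

lemma exists_right_ne (α : MulAut K)
    (S : Finset (zSemidirect K α)) (hS : Subgroup.closure (S : Set (zSemidirect K α)) = ⊤) :
    ∃ s ∈ S, s.right ≠ 1 := by
  by_contra! hcon
  have h1 : Subgroup.closure (S : Set (zSemidirect K α)) ≤
      (SemidirectProduct.rightHom : zSemidirect K α →* _).ker := by
    refine (Subgroup.closure_le _).2 fun a ha => ?_
    exact hcon a ha
  have h2 : (SemidirectProduct.inr (Multiplicative.ofAdd 1) : zSemidirect K α) ∈
    (SemidirectProduct.rightHom : zSemidirect K α →* _).ker := h1 (by rw [hS]; trivial)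
  rw [MonoidHom.mem_ker, SemidirectProduct.rightHom_inr] at h2
  exact absurd h2 (by decide)

lemma sq_ne_one (hLI : LocallyIndicable K) (c : K) (hc : c ≠ 1) : c ^ 2 ≠ 1 := by
  intro h
  have hmem : c ∈ Subgroup.closure ({c} : Set K) := Subgroup.subset_closure rfl
  obtain ⟨F, hF, x, hx, hFx⟩ := li_functional hLI (Subgroup.closure {c})
    ⟨{c}, by simp⟩ (by simpa using hc)
  have h1 := hF c hmem c hmem
  rw [← pow_two, h, fun_one hF] at h1
  rw [Subgroup.mem_closure_singleton] at hx
  obtain ⟨n, rfl⟩ := hx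
  rw [fun_zpow hF c hmem] at hFx
  apply hFx
  rw [show F c = 0 by omega, mul_zero]

end Final

/-- For every `u > 1` and `d : ℕ` there is `k > 1` such that for every
nontrivial finitely generated locally indicable group `K` all of whose finitely generated
subgroups `H` satisfy `ω(H) ≥ u`, or `H ≅ ℤⁿ` for some `n ≤ d`, or `H` is the Klein
bottle group, and every automorphism `α` of `K` with no periodic conjugacy classes,
`ω(K ⋊_α ℤ) ≥ k`. -/
theorem statement4 (u : ℝ) (hu : 1 < u) (d : ℕ) :
    ∃ k : ℝ, 1 < k ∧
      ∀ (K : Type u) [Group K], Group.FG K → LocallyIndicable K → Nontrivial K →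
        (∀ H : Subgroup K, H.FG →
          u ≤ growthOmega ↥H ∨
          (∃ n : ℕ, n ≤ d ∧ Nonempty (↥H ≃* Multiplicative (Fin n → ℤ))) ∨
          Nonempty (↥H ≃* KleinBottleGroup)) →
        ∀ α : MulAut K, ¬ HasPeriodicConjugacyClass α →
          k ≤ growthOmega (zSemidirect K α) := by
  classical
  set D := max d 2 with hD
  obtain ⟨q, hq1, hq⟩ := exists_uniform_exponent D
  refine ⟨min (((1 + u) / 2) ^ (1 / ((4 + 2 * D : ℕ) : ℝ))) ((2 : ℝ) ^ (1 / ((8 + q : ℕ) : ℝ))),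
    ?_, ?_⟩
  · refine lt_min (Real.one_lt_rpow (by linarith) (by positivity))
      (Real.one_lt_rpow (by norm_num) (by positivity))
  intro K _ hK hLI hnt hsub α hα
  refine le_csInf ?_ ?_
  · obtain ⟨S, hS⟩ := (zSemidirect_fg hK α).out
    exact ⟨_, S, hS, rfl⟩
  rintro _ ⟨S, hS, rfl⟩
  obtain ⟨a, ha, b, hb, hab⟩ := exists_noncomm α hα S hS
  obtain ⟨s, hs, hsr⟩ := exists_right_ne α S hS
  let ι : K →* zSemidirect K α := SemidirectProduct.inl
  have hι : Function.Injective ι := SemidirectProduct.inl_injective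
  -- the short element of `K`
  obtain ⟨c, hc⟩ : ∃ c : K, ι c = a * b * a⁻¹ * b⁻¹ := by
    have : a * b * a⁻¹ * b⁻¹ ∈ (SemidirectProduct.inl : K →* zSemidirect K α).range := by
      rw [SemidirectProduct.range_inl_eq_ker_rightHom, MonoidHom.mem_ker]
      simp only [map_mul, map_inv]
      rw [mul_inv_eq_one, mul_inv_eq_iff_eq_mul, mul_comm]
    exact this
  have hc1 : c ≠ 1 := by
    rintro rfl
    rw [map_one] at hc
    apply hab
    have := hc.symm
    rwa [mul_inv_eq_one, mul_inv_eq_iff_eq_mul] at this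
  have hcS : ι c ∈ wordBall S 4 := by
    rw [hc]
    exact wordBall_mul S (wordBall_mul S (wordBall_mul S (wordBall_gen S ha) (wordBall_gen S hb))
      (wordBall_inv S (wordBall_gen S ha))) (wordBall_inv S (wordBall_gen S hb))
  -- the automorphism
  let β : MulAut K := MulAut.conj s.left * α ^ s.right.toAdd
  have hβ1 : ∀ x, ι (β x) = s * ι x * s⁻¹ := fun x => (conj_inl α s x).symm
  have hβn : ∀ (n : ℕ) x, ι ((β ^ n) x) = s ^ n * ι x * (s ^ n)⁻¹ := by
    intro n
    induction n with
    | zero => simp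
    | succ n ih =>
      intro x
      rw [pow_succ', MulAut.mul_apply, hβ1, ih, pow_succ']
      group
  have hβ : ∀ k : ℕ, 0 < k → ∀ w, (β ^ k) w = w → w = 1 := by
    intro k hk w hw
    by_contra hw1
    have h1 := hβn k w
    rw [hw] at h1
    have h2 := hι (h1.trans (conj_inl α (s ^ k) w))
    refine hα ⟨w, (s ^ k).right.toAdd, (s ^ k).left⁻¹, hw1, ?_, ?_⟩
    · have h3 : (s ^ k).right = s.right ^ k :=
        map_pow (SemidirectProduct.rightHom : zSemidirect K α →* _) s k
      rw [h3, toAdd_pow]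
      simp only [nsmul_eq_mul]
      refine mul_ne_zero (by exact_mod_cast hk.ne') ?_
      exact fun h => hsr h
    · rw [eq_mul_inv_iff_mul_eq] at h2
      rw [inv_inv, mul_assoc, h2, inv_mul_cancel_left]
  have hsS : ∀ n, s ^ n ∈ wordBall S n := fun n => by
    simpa using wordBall_pow S (wordBall_gen S hs) n
  -- the subgroup
  let T : Finset K := (Finset.range (D + 1)).image (fun i => (β ^ i) c)
  have hT : ∀ x ∈ T, ι x ∈ wordBall S (4 + 2 * D) := by
    intro x hx
    obtain ⟨i, hi, rfl⟩ := Finset.mem_image.1 hx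
    have hi' := Finset.mem_range.1 hi
    rw [hβn]
    refine wordBall_mono S (by omega) (wordBall_mul S (wordBall_mul S (hsS i) hcS)
      (wordBall_inv S (hsS i)))
  have hTc : ∀ i, i ≤ D → (β ^ i) c ∈ Subgroup.closure (T : Set K) := fun i hi =>
    Subgroup.subset_closure (Finset.mem_coe.2 (Finset.mem_image.2
      ⟨i, Finset.mem_range.2 (by omega), rfl⟩))
  have hsmall : u ≤ growthOmega ↥(Subgroup.closure (T : Set K)) ∨
      ∃ n, n ≤ D ∧ ∃ φ : Multiplicative (Fin n → ℤ) →* K,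
        ∀ x ∈ Subgroup.closure (T : Set K), ∃ z, φ z = x ^ 2 := by
    rcases hsub (Subgroup.closure (T : Set K)) ⟨T, rfl⟩ with h | ⟨n, hn, ⟨e⟩⟩ | ⟨⟨e⟩⟩
    · exact Or.inl h
    · refine Or.inr ⟨n, by omega, (Subgroup.subtype _).comp e.symm.toMonoidHom, fun x hx => ?_⟩
      exact ⟨e (⟨x, hx⟩ ^ 2), by simp⟩
    · obtain ⟨ψ, hψ⟩ := klein_squares
      refine Or.inr ⟨2, by omega, ((Subgroup.subtype _).comp e.symm.toMonoidHom).comp ψ,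
        fun x hx => ?_⟩
      obtain ⟨z, hz⟩ := hψ (e ⟨x, hx⟩)
      exact ⟨z, by simp [hz]⟩
  rcases hsmall with h | ⟨n, hn, φ, hφ⟩
  · exact (min_le_left _ _).trans (growth_of_subgroup ι hι S T (4 + 2 * D) (by omega) hT u hu h)
  refine (min_le_right _ _).trans (le_growthRate S (8 + q) (by omega) 2 (by norm_num) ?_)
  have hinj := core hLI β D n q hn hq1 hq (c ^ 2) (sq_ne_one hLI c hc1) φ
    (fun i hi => by rw [map_pow]; exact hφ _ (hTc i hi)) hβ
  have hball : ∀ l : List Bool, ι (posWord β q (c ^ 2) l) * s ^ (q * l.length) ∈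
      wordBall S ((8 + q) * l.length) := by
    intro l
    induction l with
    | nil => simpa [posWord] using wordBall_one S _
    | cons b l ih =>
      have h1 : ι (if b then c ^ 2 else 1) ∈ wordBall S 8 := by
        cases b
        · simpa using wordBall_one S _
        · simpa using wordBall_pow S hcS 2
      have h2 := wordBall_mul S ih (wordBall_mul S h1 (hsS q))
      rw [List.length_cons, Nat.mul_succ]
      convert h2 using 1
      rw [posWord, map_mul, hβn, Nat.mul_succ, pow_add]
      group
  refine (Eventually.of_forall fun m => ?_).frequently
  let f : List.Vector Bool m → zSemidirect K α := fun l =>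
    ι (posWord β q (c ^ 2) l.1) * s ^ (q * m)
  have hf : Function.Injective f := by
    intro l l' h
    exact Subtype.ext (hinj l.1 l'.1 (l.2.trans l'.2.symm) (hι (mul_right_cancel h)))
  have h1 : (f '' Set.univ).ncard ≤ (wordBall S ((8 + q) * m)).ncard := by
    refine Set.ncard_le_ncard ?_ (wordBall_finite S _)
    rintro _ ⟨l, _, rfl⟩
    have := hball l.1
    rw [l.2] at this
    exact this
  rw [Set.ncard_image_of_injective _ hf, Set.ncard_univ, Nat.card_eq_fintype_card,
    card_vector, Fintype.card_bool] at h1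
  exact_mod_cast h1
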